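/- Effective one-body potential in the n-th Landau level (one-body part of Theorem 2.1, matrix-element form): let V : ℝ² → ℂ be smooth with V and all its partial derivatives polynomially bounded, let n ∈ ℕ, and let φ_{n,m}(z) = (π n! m!)^{−1/2} ((z̄ − ∂_z)^n (w ↦ w^m))(z) e^{−|z|²/2}. Then for all m, m′ ∈ ℕ: ∫_{ℝ²} V(r) · conj(φ_{n,m′}(r)) · φ_{n,m}(r) d²r = ∫_{ℝ²} Vₙ(r) · conj(φ_{0,m′}(r)) · φ_{0,m}(r) d²r, where Vₙ = Lₙ(−¼Δ) V = Σ_{l=0}^{n} C(n,l) (1/l!) (¼Δ)^l V, with Δ the Laplacian on ℝ². Thus the matrix of V in the n-th Landau level basis equals the matrix of the effective potential Vₙ in the lowest Landau level basis. -/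

import Mathlib

open MeasureTheory

noncomputable section

/-- Wirtinger derivative `∂_z F = ½(∂_x F − i ∂_y F)`. -/
def dz (F : ℂ → ℂ) (z : ℂ) : ℂ :=
  (1 / 2 : ℂ) * (fderiv ℝ F z 1 - Complex.I * fderiv ℝ F z Complex.I)

/-- The operator `z̄ − ∂_z`. -/
def Tbar (F : ℂ → ℂ) : ℂ → ℂ := fun z => (starRingEnd ℂ) z * F z - dz F z

/-- The Landau-level basis function `φ_{n,m}` (units `B = 2`). -/
def phi (n m : ℕ) (z : ℂ) : ℂ :=
  (Real.sqrt (Real.pi * n.factorial * m.factorial) : ℂ)⁻¹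
    * (Tbar^[n] (fun w => w ^ m)) z * Complex.exp (-(Complex.normSq z : ℂ) / 2)

/-- The Laplacian `Δ = ∂_x² + ∂_y²` on functions `ℝ² ≃ ℂ → ℂ`. -/
def lapC (F : ℂ → ℂ) : ℂ → ℂ :=
  fun z => fderiv ℝ (fun w => fderiv ℝ F w 1) z 1
    + fderiv ℝ (fun w => fderiv ℝ F w Complex.I) z Complex.I

/-- The effective-potential operator `Lₙ(−¼Δ) = Σ_{l=0}^n C(n,l)(1/l!)(¼Δ)^l`. -/
def LagOpV (n : ℕ) (V : ℂ → ℂ) : ℂ → ℂ :=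
  fun z => ∑ l ∈ Finset.range (n + 1),
    (n.choose l : ℂ) * (1 / 4 : ℂ) ^ l * (l.factorial : ℂ)⁻¹ * (lapC^[l] V) z

open Function

/-- Wirtinger derivative `∂_{z̄} F = ½(∂_x F + i ∂_y F)`. -/
def dzbar (F : ℂ → ℂ) (z : ℂ) : ℂ :=
  (1 / 2 : ℂ) * (fderiv ℝ F z 1 + Complex.I * fderiv ℝ F z Complex.I)

/-- The operator `z − ∂_{z̄}`, the complex conjugate of `Tbar`. -/
def TbarConj (F : ℂ → ℂ) : ℂ → ℂ := fun z => z * F z - dzbar F z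

/-- The Gaussian weight `exp (-|z|²)`. -/
def gaussWeight (z : ℂ) : ℂ := ((Real.exp (-‖z‖ ^ 2) : ℝ) : ℂ)

namespace Function.HasTemperateGrowth

variable {F G : ℂ → ℂ}

lemma differentiable (hF : F.HasTemperateGrowth) : Differentiable ℝ F :=
  hF.1.differentiable (by simp)

lemma fderiv_right (hF : F.HasTemperateGrowth) : (fderiv ℝ F).HasTemperateGrowth := by
  refine ⟨hF.1.fderiv_right (by simp), fun n => ?_⟩
  obtain ⟨k, C, h⟩ := hF.2 (n + 1)
  exact ⟨k, C, fun x => by simpa [norm_iteratedFDeriv_fderiv] using h x⟩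

lemma fderiv_apply (hF : F.HasTemperateGrowth) (v : ℂ) :
    (fun z => fderiv ℝ F z v).HasTemperateGrowth :=
  (ContinuousLinearMap.apply ℝ ℂ v).hasTemperateGrowth.comp hF.fderiv_right

lemma dz (hF : F.HasTemperateGrowth) : (dz F).HasTemperateGrowth :=
  (const _).fun_mul ((hF.fderiv_apply 1).fun_sub ((const _).fun_mul (hF.fderiv_apply _)))

lemma dzbar (hF : F.HasTemperateGrowth) : (dzbar F).HasTemperateGrowth :=
  (const _).fun_mul ((hF.fderiv_apply 1).fun_add ((const _).fun_mul (hF.fderiv_apply _)))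

lemma conj (hF : F.HasTemperateGrowth) :
    (fun z => (starRingEnd ℂ) (F z)).HasTemperateGrowth :=
  (Complex.conjCLE : ℂ ≃L[ℝ] ℂ).hasTemperateGrowth.comp hF

lemma tbar (hF : F.HasTemperateGrowth) : (Tbar F).HasTemperateGrowth :=
  (id'.conj.fun_mul hF).fun_sub hF.dz

lemma tbarConj (hF : F.HasTemperateGrowth) : (TbarConj F).HasTemperateGrowth :=
  (id'.fun_mul hF).fun_sub hF.dzbar

/-- Temperate growth is preserved by iterating an operator that preserves it. -/
lemma iterate_op {T : (ℂ → ℂ) → ℂ → ℂ}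
    (hT : ∀ {F : ℂ → ℂ}, F.HasTemperateGrowth → (T F).HasTemperateGrowth)
    (hF : F.HasTemperateGrowth) (n : ℕ) : (T^[n] F).HasTemperateGrowth := by
  induction n generalizing F with
  | zero => exact hF
  | succ n ih => exact ih (hT hF)

end Function.HasTemperateGrowth

section Wirtinger

variable {F G : ℂ → ℂ}

lemma dz_mul (hF : Differentiable ℝ F) (hG : Differentiable ℝ G) (z : ℂ) :
    dz (fun w => F w * G w) z = dz F z * G z + F z * dz G z := by
  simp only [dz, fderiv_fun_mul (hF z) (hG z), add_apply,
    smul_apply, smul_eq_mul]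
  ring

lemma dzbar_mul (hF : Differentiable ℝ F) (hG : Differentiable ℝ G) (z : ℂ) :
    dzbar (fun w => F w * G w) z = dzbar F z * G z + F z * dzbar G z := by
  simp only [dzbar, fderiv_fun_mul (hF z) (hG z), add_apply,
    smul_apply, smul_eq_mul]
  ring

lemma fderiv_conj (hF : Differentiable ℝ F) (z v : ℂ) :
    fderiv ℝ (fun w => (starRingEnd ℂ) (F w)) z v = (starRingEnd ℂ) (fderiv ℝ F z v) := by
  have h := ((Complex.conjCLE : ℂ ≃L[ℝ] ℂ).hasFDerivAt (x := F z)).comp z (hF z).hasFDerivAt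
  exact congrArg (fun L : ℂ →L[ℝ] ℂ => L v) h.fderiv

lemma dzbar_conj (hF : Differentiable ℝ F) (z : ℂ) :
    dzbar (fun w => (starRingEnd ℂ) (F w)) z = (starRingEnd ℂ) (dz F z) := by
  simp only [dzbar, dz, fderiv_conj hF, map_mul, map_sub, map_div₀, map_one,
    Complex.conj_I, Complex.conj_ofNat]
  ring

lemma dz_conj (hF : Differentiable ℝ F) (z : ℂ) :
    dz (fun w => (starRingEnd ℂ) (F w)) z = (starRingEnd ℂ) (dzbar F z) := by
  simp only [dzbar, dz, fderiv_conj hF, map_mul, map_add, map_div₀, map_one,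
    Complex.conj_I, Complex.conj_ofNat]
  ring

lemma dzbar_eq_zero_of_differentiable (hF : Differentiable ℂ F) : dzbar F = 0 := by
  funext z
  have h := (hF z).fderiv_restrictScalars ℝ
  have h1 : fderiv ℂ F z Complex.I = Complex.I * fderiv ℂ F z 1 := by
    rw [← smul_eq_mul, ← map_smul, smul_eq_mul, mul_one]
  simp only [dzbar, h, ContinuousLinearMap.coe_restrictScalars', h1, Pi.zero_apply]
  linear_combination (1 / 2 : ℂ) * fderiv ℂ F z 1 * Complex.I_mul_I

lemma dz_conj_eq_zero_of_differentiable (hF : Differentiable ℂ F) :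
    dz (fun w => (starRingEnd ℂ) (F w)) = 0 := by
  funext z
  rw [dz_conj (hF.restrictScalars ℝ), dzbar_eq_zero_of_differentiable hF]
  simp

lemma dz_id (z : ℂ) : dz (fun w => w) z = 1 := by
  simp only [dz, fderiv_fun_id, ContinuousLinearMap.id_apply, Complex.I_mul_I]
  norm_num

lemma tbarConj_conj (hF : Differentiable ℝ F) :
    TbarConj (fun w => (starRingEnd ℂ) (F w)) = fun w => (starRingEnd ℂ) (Tbar F w) := by
  funext z
  simp [TbarConj, Tbar, dzbar_conj hF]

lemma conj_tbar_iterate (hF : F.HasTemperateGrowth) (n : ℕ) :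
    (fun z => (starRingEnd ℂ) ((Tbar^[n] F) z))
      = TbarConj^[n] (fun z => (starRingEnd ℂ) (F z)) := by
  induction n with
  | zero => rfl
  | succ n ih =>
    rw [iterate_succ_apply', iterate_succ_apply', ← ih,
      tbarConj_conj (HasTemperateGrowth.iterate_op .tbar hF n).differentiable]

lemma fderiv_fderiv_apply (hF : F.HasTemperateGrowth) (u v z : ℂ) :
    fderiv ℝ (fun w => fderiv ℝ F w u) z v = fderiv ℝ (fderiv ℝ F) z v u := by
  have hd : Differentiable ℝ (fderiv ℝ F) := hF.fderiv_right.1.differentiable (by simp)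
  have h := ((ContinuousLinearMap.apply ℝ ℂ u).hasFDerivAt
    (x := fderiv ℝ F z)).comp z (hd z).hasFDerivAt
  exact congrArg (fun L : ℂ →L[ℝ] ℂ => L v) h.fderiv

lemma fderiv_dz (hF : F.HasTemperateGrowth) (z v : ℂ) :
    fderiv ℝ (dz F) z v = (1 / 2 : ℂ) * (fderiv ℝ (fderiv ℝ F) z v 1
      - Complex.I * fderiv ℝ (fderiv ℝ F) z v Complex.I) := by
  have h1 := (hF.fderiv_apply 1).differentiable z
  have h2 := (hF.fderiv_apply Complex.I).differentiable z
  have h := (h1.hasFDerivAt.sub (h2.hasFDerivAt.const_mul Complex.I)).const_mul (1 / 2 : ℂ)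
  rw [show fderiv ℝ (dz F) z = _ from h.fderiv]
  simp [fderiv_fderiv_apply hF, mul_sub]

lemma fderiv_dzbar (hF : F.HasTemperateGrowth) (z v : ℂ) :
    fderiv ℝ (dzbar F) z v = (1 / 2 : ℂ) * (fderiv ℝ (fderiv ℝ F) z v 1
      + Complex.I * fderiv ℝ (fderiv ℝ F) z v Complex.I) := by
  have h1 := (hF.fderiv_apply 1).differentiable z
  have h2 := (hF.fderiv_apply Complex.I).differentiable z
  have h := (h1.hasFDerivAt.add (h2.hasFDerivAt.const_mul Complex.I)).const_mul (1 / 2 : ℂ)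
  rw [show fderiv ℝ (dzbar F) z = _ from h.fderiv]
  simp [fderiv_fderiv_apply hF, mul_add]

lemma fderiv_fderiv_symm (hF : F.HasTemperateGrowth) (u v z : ℂ) :
    fderiv ℝ (fderiv ℝ F) z u v = fderiv ℝ (fderiv ℝ F) z v u := by
  have h : ContDiff ℝ 2 F := hF.1.of_le (WithTop.coe_le_coe.2 (le_top (a := (2 : ℕ∞))))
  exact h.contDiffAt.isSymmSndFDerivAt (by simp) u v

lemma dz_dzbar (hF : F.HasTemperateGrowth) : dz (dzbar F) = dzbar (dz F) := by
  funext z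
  rw [dz, dzbar]
  simp only [fderiv_dz hF, fderiv_dzbar hF, fderiv_fderiv_symm hF 1 Complex.I]
  ring

lemma dzbar_dz (hF : F.HasTemperateGrowth) (z : ℂ) :
    dzbar (dz F) z = (1 / 4 : ℂ) * lapC F z := by
  rw [dzbar, lapC]
  simp only [fderiv_dz hF, fderiv_fderiv_apply hF, fderiv_fderiv_symm hF 1 Complex.I]
  linear_combination (-1 / 4 : ℂ) * fderiv ℝ (fderiv ℝ F) z Complex.I Complex.I * Complex.I_mul_I

lemma dzbar_const_mul (c : ℂ) (hF : Differentiable ℝ F) :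
    dzbar (fun w => c * F w) = fun w => c * dzbar F w := by
  funext z
  rw [dzbar_mul (differentiable_const c) hF]
  simp [dzbar]

lemma dz_const_mul (c : ℂ) (hF : Differentiable ℝ F) :
    dz (fun w => c * F w) = fun w => c * dz F w := by
  funext z
  rw [dz_mul (differentiable_const c) hF]
  simp [dz]

lemma tbarConj_const_mul (c : ℂ) (hF : Differentiable ℝ F) :
    TbarConj (fun w => c * F w) = fun w => c * TbarConj F w := by
  funext z
  simp only [TbarConj, dzbar_const_mul c hF]
  ring

lemma dz_iterate_dzbar (hF : F.HasTemperateGrowth) (n : ℕ) :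
    dz (dzbar^[n] F) = dzbar^[n] (dz F) := by
  induction n generalizing F with
  | zero => rfl
  | succ n ih => rw [iterate_succ_apply, ih hF.dzbar, dz_dzbar hF, iterate_succ_apply]

lemma lapC_hasTemperateGrowth (hF : F.HasTemperateGrowth) : (lapC F).HasTemperateGrowth :=
  ((hF.fderiv_apply 1).fderiv_apply 1).fun_add
    ((hF.fderiv_apply Complex.I).fderiv_apply Complex.I)

lemma dzbar_iterate_dz_iterate (hF : F.HasTemperateGrowth) (n : ℕ) (z : ℂ) :
    (dzbar^[n] (dz^[n] F)) z = (1 / 4 : ℂ) ^ n * (lapC^[n] F) z := by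
  induction n generalizing z with
  | zero => simp
  | succ n ih =>
    have h := HasTemperateGrowth.iterate_op .dz hF n
    have hl := HasTemperateGrowth.iterate_op lapC_hasTemperateGrowth hF n
    rw [iterate_succ_apply' dz, iterate_succ_apply' dzbar, ← dz_iterate_dzbar h,
      show dzbar^[n] (dz^[n] F) = fun w => (1 / 4 : ℂ) ^ n * (lapC^[n] F) w from funext ih,
      dz_const_mul _ hl.differentiable, dzbar_const_mul _ hl.dz.differentiable,
      iterate_succ_apply' lapC]
    simp only [dzbar_dz hl]
    ring

/-- The canonical commutation relation `[∂_z, z − ∂_{z̄}] = 1`. -/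
lemma dz_tbarConj (hF : F.HasTemperateGrowth) (z : ℂ) :
    dz (TbarConj F) z = F z + TbarConj (dz F) z := by
  have h1 : Differentiable ℝ fun w : ℂ => w * F w := differentiable_fun_id.mul hF.differentiable
  have h2 : dz (TbarConj F) z = dz (fun w => w * F w) z - dz (dzbar F) z := by
    have h : fderiv ℝ (TbarConj F) z = fderiv ℝ (fun w => w * F w) z - fderiv ℝ (dzbar F) z :=
      fderiv_fun_sub (h1 z) (hF.dzbar.differentiable z)
    simp only [dz, h, sub_apply]
    ring
  rw [h2, dz_mul differentiable_fun_id hF.differentiable, dz_id, dz_dzbar hF, TbarConj]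
  ring

lemma dz_tbarConj_iterate (hF : F.HasTemperateGrowth) (h0 : dz F = 0) (n : ℕ) :
    dz (TbarConj^[n] F) = fun z => (n : ℂ) * (TbarConj^[n - 1] F) z := by
  induction n with
  | zero => simpa using! h0
  | succ n ih =>
    funext z
    have h (k : ℕ) := HasTemperateGrowth.iterate_op .tbarConj hF k
    rw [iterate_succ_apply', dz_tbarConj (h n), ih, tbarConj_const_mul _ (h _).differentiable]
    cases n with
    | zero => simp
    | succ n =>
      simp only [Nat.add_sub_cancel, ← iterate_succ_apply' TbarConj]
      push_cast
      ring

end Wirtinger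

section GaussianIntegral

variable {F G : ℂ → ℂ}

lemma hasFDerivAt_gaussWeight (z : ℂ) :
    HasFDerivAt gaussWeight
      (Complex.ofRealCLM.comp (Real.exp (-‖z‖ ^ 2) • -(2 • innerSL ℝ z))) z :=
  Complex.ofRealCLM.hasFDerivAt.comp z (hasStrictFDerivAt_norm_sq z).hasFDerivAt.neg.exp

lemma fderiv_gaussWeight (z v : ℂ) :
    fderiv ℝ gaussWeight z v = -2 * ((inner ℝ z v : ℝ) : ℂ) * gaussWeight z := by
  rw [(hasFDerivAt_gaussWeight z).fderiv]
  simp [gaussWeight]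
  ring

lemma integrable_mul_gaussWeight (hF : F.HasTemperateGrowth) :
    Integrable fun z => F z * gaussWeight z := by
  obtain ⟨k, C, hC, h⟩ := hF.norm_iteratedFDeriv_le_uniform 0
  have hexp : Integrable fun z : ℂ => Real.exp (-(1 / 2) * ‖z‖ ^ 2) := by
    have := (GaussianFourier.integrable_cexp_neg_mul_sq_norm_add (V := ℂ) (b := 1 / 2)
      (by norm_num) 0 0).norm
    convert this using 2 with z
    rw [Complex.norm_exp]
    have hre : ((‖z‖ : ℂ) ^ 2).re = ‖z‖ ^ 2 := by rw [← Complex.ofReal_pow, Complex.ofReal_re]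
    congr 1
    norm_cast
    simp [hre]
  have hcont : Continuous fun z => F z * gaussWeight z :=
    hF.1.continuous.mul (continuous_iff_continuousAt.2
      fun z => (hasFDerivAt_gaussWeight z).continuousAt)
  refine (hexp.const_mul (C * (k.factorial * Real.exp (3 / 2)))).mono'
    hcont.aestronglyMeasurable (Filter.Eventually.of_forall fun z => ?_)
  have hFz : ‖F z‖ ≤ C * (1 + ‖z‖) ^ k := by simpa using h 0 le_rfl z
  have hpow : (1 + ‖z‖) ^ k ≤ k.factorial * Real.exp (1 + ‖z‖) := by
    have := Real.pow_div_factorial_le_exp (1 + ‖z‖) (by positivity) k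
    rwa [div_le_iff₀' (by positivity)] at this
  have hw : ‖gaussWeight z‖ = Real.exp (-‖z‖ ^ 2) := by
    rw [gaussWeight, Complex.norm_real, Real.norm_of_nonneg (Real.exp_pos _).le]
  calc ‖F z * gaussWeight z‖
      ≤ C * (k.factorial * Real.exp (1 + ‖z‖)) * Real.exp (-‖z‖ ^ 2) := by
        rw [norm_mul, hw]
        gcongr
        exact hFz.trans (by gcongr)
    _ = C * k.factorial * Real.exp (1 + ‖z‖ + -‖z‖ ^ 2) := by
        rw [Real.exp_add _ (-‖z‖ ^ 2)]
        ring
    _ ≤ C * k.factorial * Real.exp (3 / 2 + -(1 / 2) * ‖z‖ ^ 2) := by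
        gcongr C * k.factorial * Real.exp ?_
        nlinarith [sq_nonneg (‖z‖ - 1)]
    _ = C * (k.factorial * Real.exp (3 / 2)) * Real.exp (-(1 / 2) * ‖z‖ ^ 2) := by
        rw [Real.exp_add]
        ring

lemma integral_fderiv_mul_gaussWeight (hF : F.HasTemperateGrowth) (v : ℂ) :
    ∫ z, fderiv ℝ F z v * gaussWeight z
      = ∫ z, 2 * ((inner ℝ z v : ℝ) : ℂ) * F z * gaussWeight z := by
  have hi : (fun z : ℂ => ((inner ℝ z v : ℝ) : ℂ)).HasTemperateGrowth :=
    Complex.hasTemperateGrowth_ofReal.comp (hasTemperateGrowth_inner_left v)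
  have hd : Differentiable ℝ gaussWeight := fun z => (hasFDerivAt_gaussWeight z).differentiableAt
  have h := integral_mul_fderiv_eq_neg_fderiv_mul_of_integrable (μ := volume) (v := v)
    (integrable_mul_gaussWeight (hF.fderiv_apply v))
    (by
      convert integrable_mul_gaussWeight (((HasTemperateGrowth.const (-2)).fun_mul hi).fun_mul hF)
        using 2 with z
      rw [fderiv_gaussWeight]
      ring)
    (integrable_mul_gaussWeight hF) (fun z _ => hF.differentiable z) (fun z _ => hd z)
  rw [← neg_eq_iff_eq_neg.mpr h, ← integral_neg]
  congr 1 with z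
  rw [fderiv_gaussWeight]
  ring

lemma integral_dz_mul_gaussWeight (hF : F.HasTemperateGrowth) :
    ∫ z, dz F z * gaussWeight z = ∫ z, (starRingEnd ℂ) z * F z * gaussWeight z := by
  have hi (v : ℂ) : (fun z : ℂ => 2 * ((inner ℝ z v : ℝ) : ℂ)).HasTemperateGrowth :=
    (HasTemperateGrowth.const 2).fun_mul
      (Complex.hasTemperateGrowth_ofReal.comp (hasTemperateGrowth_inner_left v))
  have hd (v : ℂ) := integrable_mul_gaussWeight (hF.fderiv_apply v)
  have hm (v : ℂ) := integrable_mul_gaussWeight ((hi v).fun_mul hF)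
  calc ∫ z, dz F z * gaussWeight z
      = (1 / 2 : ℂ) * ((∫ z, fderiv ℝ F z 1 * gaussWeight z)
          - Complex.I * ∫ z, fderiv ℝ F z Complex.I * gaussWeight z) := by
        rw [← integral_const_mul Complex.I, ← integral_sub (hd 1) ((hd Complex.I).const_mul _),
          ← integral_const_mul]
        congr 1 with z
        rw [dz]
        ring
    _ = ∫ z, (starRingEnd ℂ) z * F z * gaussWeight z := by
        rw [integral_fderiv_mul_gaussWeight hF, integral_fderiv_mul_gaussWeight hF,
          ← integral_const_mul Complex.I, ← integral_sub (hm 1) ((hm Complex.I).const_mul _),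
          ← integral_const_mul]
        congr 1 with z
        have hz : (starRingEnd ℂ) z = z.re - Complex.I * z.im := by
          apply Complex.ext <;> simp
        rw [hz]
        simp [Complex.inner]
        ring

lemma integral_dzbar_mul_gaussWeight (hF : F.HasTemperateGrowth) :
    ∫ z, dzbar F z * gaussWeight z = ∫ z, z * F z * gaussWeight z := by
  have hi (v : ℂ) : (fun z : ℂ => 2 * ((inner ℝ z v : ℝ) : ℂ)).HasTemperateGrowth :=
    (HasTemperateGrowth.const 2).fun_mul
      (Complex.hasTemperateGrowth_ofReal.comp (hasTemperateGrowth_inner_left v))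
  have hd (v : ℂ) := integrable_mul_gaussWeight (hF.fderiv_apply v)
  have hm (v : ℂ) := integrable_mul_gaussWeight ((hi v).fun_mul hF)
  calc ∫ z, dzbar F z * gaussWeight z
      = (1 / 2 : ℂ) * ((∫ z, fderiv ℝ F z 1 * gaussWeight z)
          + Complex.I * ∫ z, fderiv ℝ F z Complex.I * gaussWeight z) := by
        rw [← integral_const_mul Complex.I, ← integral_add (hd 1) ((hd Complex.I).const_mul _),
          ← integral_const_mul]
        congr 1 with z
        rw [dzbar]
        ring
    _ = ∫ z, z * F z * gaussWeight z := by
        rw [integral_fderiv_mul_gaussWeight hF, integral_fderiv_mul_gaussWeight hF,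
          ← integral_const_mul Complex.I, ← integral_add (hm 1) ((hm Complex.I).const_mul _),
          ← integral_const_mul]
        congr 1 with z
        have hz : z = z.re + Complex.I * z.im := by
          apply Complex.ext <;> simp
        rw [hz]
        simp [Complex.inner]
        ring

/-- `z̄ − ∂_z` is the transpose of `∂_z` for the Gaussian measure. -/
lemma integral_mul_tbar (hF : F.HasTemperateGrowth) (hG : G.HasTemperateGrowth) :
    ∫ z, G z * Tbar F z * gaussWeight z = ∫ z, dz G z * F z * gaussWeight z := by
  have h := integral_dz_mul_gaussWeight (hG.fun_mul hF)
  have h1 : Integrable fun z => dz G z * F z * gaussWeight z :=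
    integrable_mul_gaussWeight (hG.dz.fun_mul hF)
  have h2 : Integrable fun z => G z * dz F z * gaussWeight z :=
    integrable_mul_gaussWeight (hG.fun_mul hF.dz)
  have h3 : Integrable fun z => (starRingEnd ℂ) z * (G z * F z) * gaussWeight z :=
    integrable_mul_gaussWeight (HasTemperateGrowth.id'.conj.fun_mul (hG.fun_mul hF))
  simp only [dz_mul hG.differentiable hF.differentiable, add_mul] at h
  rw [integral_add h1 h2] at h
  rw [eq_sub_of_add_eq h, ← integral_sub h3 h2]
  congr 1 with z
  rw [Tbar]
  ring

lemma integral_mul_tbarConj (hF : F.HasTemperateGrowth) (hG : G.HasTemperateGrowth) :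
    ∫ z, G z * TbarConj F z * gaussWeight z = ∫ z, dzbar G z * F z * gaussWeight z := by
  have h := integral_dzbar_mul_gaussWeight (hG.fun_mul hF)
  have h1 : Integrable fun z => dzbar G z * F z * gaussWeight z :=
    integrable_mul_gaussWeight (hG.dzbar.fun_mul hF)
  have h2 : Integrable fun z => G z * dzbar F z * gaussWeight z :=
    integrable_mul_gaussWeight (hG.fun_mul hF.dzbar)
  have h3 : Integrable fun z => z * (G z * F z) * gaussWeight z :=
    integrable_mul_gaussWeight (HasTemperateGrowth.id'.fun_mul (hG.fun_mul hF))
  simp only [dzbar_mul hG.differentiable hF.differentiable, add_mul] at h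
  rw [integral_add h1 h2] at h
  rw [eq_sub_of_add_eq h, ← integral_sub h3 h2]
  congr 1 with z
  rw [TbarConj]
  ring

variable {f g V : ℂ → ℂ}

lemma integral_tbarConj_iterate (hf : f.HasTemperateGrowth) (hg : g.HasTemperateGrowth)
    (hg0 : dzbar g = 0) (hV : V.HasTemperateGrowth) (b : ℕ) :
    ∫ z, V z * (TbarConj^[b] f) z * g z * gaussWeight z
      = ∫ z, (dzbar^[b] V) z * f z * g z * gaussWeight z := by
  induction b generalizing V with
  | zero => rfl
  | succ b ih =>
    have h := HasTemperateGrowth.iterate_op .tbarConj hf b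
    have h' := integral_mul_tbarConj h (hV.fun_mul hg)
    rw [iterate_succ_apply', iterate_succ_apply, ← ih hV.dzbar]
    convert h' using 3 with z z
    · ring
    · rw [dzbar_mul hV.differentiable hg.differentiable, hg0]
      simp only [Pi.zero_apply]
      ring

/-- Reduction of a matrix element between Landau levels `b` and `a` to matrix elements in the
lowest Landau level. -/
lemma integral_tbarConj_iterate_tbar_iterate (hf : f.HasTemperateGrowth)
    (hg : g.HasTemperateGrowth) (hf0 : dz f = 0) (hg0 : dzbar g = 0)
    (hV : V.HasTemperateGrowth) (a b : ℕ) :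
    ∫ z, V z * (TbarConj^[b] f) z * (Tbar^[a] g) z * gaussWeight z
      = ∑ k ∈ Finset.range (a + 1), (a.choose k * b.choose k * k.factorial : ℂ)
          * ∫ z, (dzbar^[b - k] (dz^[a - k] V)) z * f z * g z * gaussWeight z := by
  induction a generalizing V b with
  | zero => simpa using integral_tbarConj_iterate hf hg hg0 hV b
  | succ a ih =>
    have hT (k : ℕ) := HasTemperateGrowth.iterate_op .tbarConj hf k
    have hA := HasTemperateGrowth.iterate_op .tbar hg a
    have key : ∫ z, V z * (TbarConj^[b] f) z * (Tbar^[a + 1] g) z * gaussWeight z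
        = (∫ z, dz V z * (TbarConj^[b] f) z * (Tbar^[a] g) z * gaussWeight z)
          + b * ∫ z, V z * (TbarConj^[b - 1] f) z * (Tbar^[a] g) z * gaussWeight z := by
      have h1 := integrable_mul_gaussWeight ((hV.dz.fun_mul (hT b)).fun_mul hA)
      have h2 := integrable_mul_gaussWeight ((hV.fun_mul (hT (b - 1))).fun_mul hA)
      rw [iterate_succ_apply', integral_mul_tbar hA (hV.fun_mul (hT b)),
        ← integral_const_mul, ← integral_add h1 (h2.const_mul _)]
      congr 1 with z
      rw [dz_mul hV.differentiable (hT b).differentiable, dz_tbarConj_iterate hf hf0]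
      ring
    rw [key, ih hV.dz b, ih hV (b - 1)]
    obtain ⟨X, hX⟩ : ∃ X : ℕ → ℂ, ∀ k, X k =
        ∫ z, (dzbar^[b - k] (dz^[a + 1 - k] V)) z * f z * g z * gaussWeight z :=
      ⟨_, fun _ => rfl⟩
    have e1 : ∑ k ∈ Finset.range (a + 1), (a.choose k * b.choose k * k.factorial : ℂ)
          * ∫ z, (dzbar^[b - k] (dz^[a - k] (dz V))) z * f z * g z * gaussWeight z
        = ∑ k ∈ Finset.range (a + 2), (a.choose k * b.choose k * k.factorial : ℂ) * X k := by
      rw [Finset.sum_range_succ _ (a + 1), Nat.choose_succ_self]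
      simp only [Nat.cast_zero, zero_mul, add_zero]
      refine Finset.sum_congr rfl fun k hk => ?_
      rw [hX, ← iterate_succ_apply dz, Nat.succ_eq_add_one,
        ← Nat.sub_add_comm (Finset.mem_range_succ_iff.1 hk)]
    have e2 (k : ℕ) : (b : ℂ) * (b - 1).choose k = b.choose (k + 1) * (k + 1) := by
      cases b with
      | zero => simp
      | succ b => exact_mod_cast Nat.add_one_mul_choose_eq b k
    have e3 (k : ℕ) :
        ∫ z, (dzbar^[b - 1 - k] (dz^[a - k] V)) z * f z * g z * gaussWeight z = X (k + 1) := by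
      rw [hX, Nat.add_sub_add_right, Nat.sub_sub, add_comm 1 k]
    simp_rw [← hX]
    rw [e1, Finset.sum_range_succ' _ (a + 1), Finset.sum_range_succ' _ (a + 1), Finset.mul_sum,
      add_right_comm, ← Finset.sum_add_distrib]
    congr 1
    · refine Finset.sum_congr rfl fun k _ => ?_
      rw [e3, Nat.choose_succ_succ a k, Nat.factorial_succ]
      push_cast
      linear_combination (a.choose k * k.factorial * X (k + 1) : ℂ) * e2 k
    · simp

end GaussianIntegral

lemma mul_conj_phi_mul_phi (V : ℂ → ℂ) (n m m' : ℕ) (z : ℂ) :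
    V z * (starRingEnd ℂ) (phi n m' z) * phi n m z
      = ((Real.sqrt (Real.pi * n.factorial * m'.factorial) : ℂ)⁻¹
          * (Real.sqrt (Real.pi * n.factorial * m.factorial) : ℂ)⁻¹)
        * (V z * (TbarConj^[n] fun w => (starRingEnd ℂ) (w ^ m')) z
          * (Tbar^[n] fun w => w ^ m) z * gaussWeight z) := by
  have hw : (starRingEnd ℂ) (Complex.exp (-(Complex.normSq z : ℂ) / 2))
      * Complex.exp (-(Complex.normSq z : ℂ) / 2) = gaussWeight z := by
    rw [← Complex.exp_conj, ← Complex.exp_add, gaussWeight, Complex.ofReal_exp,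
      ← Complex.normSq_eq_norm_sq]
    congr 1
    simp only [map_div₀, map_neg, Complex.conj_ofReal, Complex.conj_ofNat]
    push_cast
    ring
  rw [← hw, ← conj_tbar_iterate (HasTemperateGrowth.id'.fun_pow m') n, phi, phi]
  simp only [map_mul, map_inv₀, Complex.conj_ofReal]
  ring

lemma phi_normalization (n m m' : ℕ) :
    (Real.sqrt (Real.pi * n.factorial * m'.factorial) : ℂ)⁻¹
        * (Real.sqrt (Real.pi * n.factorial * m.factorial) : ℂ)⁻¹
      = (n.factorial : ℂ)⁻¹
        * ((Real.sqrt (Real.pi * (0).factorial * m'.factorial) : ℂ)⁻¹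
          * (Real.sqrt (Real.pi * (0).factorial * m.factorial) : ℂ)⁻¹) := by
  have h (k : ℕ) : Real.sqrt (Real.pi * n.factorial * k.factorial)
      = Real.sqrt n.factorial * Real.sqrt (Real.pi * (0).factorial * k.factorial) := by
    rw [← Real.sqrt_mul (by positivity)]
    congr 1
    simp only [Nat.factorial_zero, Nat.cast_one]
    ring
  have hn : (Real.sqrt n.factorial : ℂ) * Real.sqrt n.factorial = n.factorial := by
    rw [← Complex.ofReal_mul, Real.mul_self_sqrt (by positivity), Complex.ofReal_natCast]
  rw [h, h, ← hn]
  push_cast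
  simp only [mul_inv]
  ring

/-- effective one-body potential in the `n`-th Landau level: for smooth `V`
with polynomially bounded derivatives, the matrix of `V` in the `nLL` basis equals the
matrix of `Vₙ = Lₙ(−¼Δ)V` in the `LLL` basis:
`∫ V conj(φ_{n,m′}) φ_{n,m} = ∫ Vₙ conj(φ_{0,m′}) φ_{0,m}`. -/
theorem stmt18 (n : ℕ) (V : ℂ → ℂ) (hV : ContDiff ℝ (⊤ : ℕ∞) V)
    (hpoly : ∀ j : ℕ, ∃ C : ℝ, ∃ p : ℕ, ∀ z : ℂ,
      ‖iteratedFDeriv ℝ j V z‖ ≤ C * (1 + ‖z‖) ^ p) :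
    ∀ m m' : ℕ,
      ∫ z : ℂ, V z * (starRingEnd ℂ) (phi n m' z) * phi n m z
        = ∫ z : ℂ, LagOpV n V z * (starRingEnd ℂ) (phi 0 m' z) * phi 0 m z := by
  have hVt : V.HasTemperateGrowth := ⟨hV, fun j => by
    obtain ⟨C, p, h⟩ := hpoly j
    exact ⟨p, C, h⟩⟩
  intro m m'
  have hmono (k : ℕ) : (fun w : ℂ => w ^ k).HasTemperateGrowth := HasTemperateGrowth.id'.fun_pow k
  have hdiff (k : ℕ) : Differentiable ℂ fun w : ℂ => w ^ k := by fun_prop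
  have hlap (l : ℕ) := HasTemperateGrowth.iterate_op lapC_hasTemperateGrowth hVt l
  simp only [mul_conj_phi_mul_phi]
  rw [integral_const_mul, integral_const_mul, phi_normalization,
    integral_tbarConj_iterate_tbar_iterate (hmono m').conj (hmono m)
      (dz_conj_eq_zero_of_differentiable (hdiff m')) (dzbar_eq_zero_of_differentiable (hdiff m))
      hVt n n, mul_right_comm, mul_comm]
  congr 1
  simp only [iterate_zero, id_eq, LagOpV, Finset.sum_mul]
  rw [integral_finsetSum _ fun l _ => integrable_mul_gaussWeight
      (((((HasTemperateGrowth.const _).fun_mul (hlap l)).fun_mul (hmono m').conj).fun_mul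
        (hmono m))), Finset.mul_sum, ← Finset.sum_flip]
  refine Finset.sum_congr rfl fun l hl => ?_
  have hln : l ≤ n := Finset.mem_range_succ_iff.1 hl
  have hfact : (n.choose l : ℂ) * l.factorial * (n - l).factorial = n.factorial :=
    mod_cast Nat.choose_mul_factorial_mul_factorial hln
  have hl0 : (l.factorial : ℂ) ≠ 0 := mod_cast l.factorial_ne_zero
  have hn0 : (n.factorial : ℂ) ≠ 0 := mod_cast n.factorial_ne_zero
  rw [Nat.sub_sub_self hln, Nat.choose_symm hln, ← integral_const_mul, ← integral_const_mul]
  congr 1 with z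
  rw [dzbar_iterate_dz_iterate hVt]
  field_simp
  linear_combination (n.choose l * (lapC^[l] V) z * (starRingEnd ℂ) (z ^ m') * z ^ m
    * gaussWeight z : ℂ) * hfact
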